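/- For coprime positive integers a < b and any real X > 2, \sum_{X < n \leq 2X} g_{a,b}(n)^2 \ll X^{-a/((a+b)b)}, with implied constant depending only on a and b. -/

import Mathlib

open Finset

noncomputable def g (a b n : ℕ) : ℝ :=
  ∑ p ∈ (Finset.Icc 1 n ×ˢ Finset.Icc 1 n).filter (fun p => p.1 ^ a * p.2 ^ b = n),
    (p.1 : ℝ) ^ (-(((a : ℝ) + 2 * b) / (2 * a + 2 * b))) *
      (p.2 : ℝ) ^ (-((2 * (a : ℝ) + b) / (2 * a + 2 * b)))

theorem exists_common_parametrization {a b h r H R : ℕ}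
    (hcop : a.Coprime b) (hh : h ≠ 0) (hR : R ≠ 0) (heq : h ^ a * r ^ b = H ^ a * R ^ b) :
    ∃ k l u v : ℕ, h = k * u ^ b ∧ r = l * v ^ a ∧ H = k * v ^ b ∧ R = l * u ^ a := by
  obtain ⟨h', H', hcop₁, h_eq, H_eq⟩ := Nat.exists_coprime h H
  obtain ⟨R', r', hcop₂, R_eq, r_eq⟩ := Nat.exists_coprime R r
  have hk : 0 < h.gcd H := Nat.gcd_pos_of_pos_left _ (Nat.pos_of_ne_zero hh)
  have hl : 0 < R.gcd r := Nat.gcd_pos_of_pos_left _ (Nat.pos_of_ne_zero hR)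
  generalize h.gcd H = k at *
  generalize R.gcd r = l at *
  subst h_eq H_eq R_eq r_eq
  have key : h' ^ a * r' ^ b = H' ^ a * R' ^ b := by
    have : 0 < k ^ a * l ^ b := by positivity
    refine Nat.eq_of_mul_eq_mul_left this ?_
    simp only [mul_pow] at heq
    linarith
  have h₁ : h' ^ a = R' ^ b :=
    Nat.dvd_antisymm
      ((hcop₁.pow a a).dvd_of_dvd_mul_left (Dvd.intro _ key))
      ((hcop₂.pow b b).dvd_of_dvd_mul_right (Dvd.intro_left _ key.symm))
  have h₂ : r' ^ b = H' ^ a := by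
    have : 0 < h' ^ a := by
      have : h' ≠ 0 := left_ne_zero_of_mul hh
      positivity
    rw [← h₁, mul_comm (H' ^ a)] at key
    exact Nat.eq_of_mul_eq_mul_left this key
  obtain ⟨u, hu₁, hu₂⟩ := Nat.exists_eq_pow_of_exponent_coprime_of_pow_eq_pow hcop h₁
  obtain ⟨v, hv₁, hv₂⟩ := Nat.exists_eq_pow_of_exponent_coprime_of_pow_eq_pow hcop h₂.symm
  exact ⟨k, l, u, v, by rw [hu₁, mul_comm], by rw [hv₂, mul_comm], by rw [hv₁, mul_comm],
    by rw [hu₂, mul_comm]⟩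

theorem sum_rpow_neg_le_of_pow_dyadic {b : ℕ} (hb : 0 < b) {s W : ℝ} (hs : 0 ≤ s) (hW : 0 < W)
    (S : Finset ℕ) (hS : ∀ l ∈ S, W < (l : ℝ) ^ b ∧ (l : ℝ) ^ b ≤ 2 * W) :
    ∑ l ∈ S, (l : ℝ) ^ (-s) ≤ 2 * W ^ ((1 - s) / b) := by
  set w : ℝ := W ^ (b : ℝ)⁻¹ with hw
  have hw0 : 0 < w := Real.rpow_pos_of_pos hW _
  have hwb : w ^ b = W := Real.rpow_inv_natCast_pow hW.le hb.ne'
  have hlow : ∀ l ∈ S, w < l := fun l hl ↦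
    lt_of_pow_lt_pow_left₀ b l.cast_nonneg (by rw [hwb]; exact (hS l hl).1)
  have hupp : ∀ l ∈ S, (l : ℝ) ≤ 2 * w := fun l hl ↦ by
    refine le_of_pow_le_pow_left₀ hb.ne' (by positivity) ((hS l hl).2.trans ?_)
    rw [mul_pow, hwb]
    gcongr
    exact le_self_pow₀ one_le_two hb.ne'
  have hcard : (S.card : ℝ) ≤ 2 * w := by
    have hsub : S ⊆ Icc 1 ⌊2 * w⌋₊ := fun l hl ↦ by
      have : (0 : ℝ) < l := hw0.trans (hlow l hl)
      exact mem_Icc.2 ⟨by exact_mod_cast this, Nat.le_floor (hupp l hl)⟩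
    calc (S.card : ℝ) ≤ (⌊2 * w⌋₊ : ℝ) := by simpa using card_le_card hsub
      _ ≤ 2 * w := Nat.floor_le (by positivity)
  calc ∑ l ∈ S, (l : ℝ) ^ (-s) ≤ ∑ l ∈ S, w ^ (-s) :=
        sum_le_sum fun l hl ↦
          Real.rpow_le_rpow_of_nonpos hw0 (hlow l hl).le (neg_nonpos.2 hs)
    _ = S.card * w ^ (-s) := by rw [sum_const, nsmul_eq_mul]
    _ ≤ 2 * w * w ^ (-s) := by gcongr
    _ = 2 * W ^ ((1 - s) / b) := by
        have : w * w ^ (-s) = w ^ (1 - s) := by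
          rw [sub_eq_add_neg, Real.rpow_add hw0, Real.rpow_one]
        rw [mul_assoc, this, hw, ← Real.rpow_mul hW.le, inv_mul_eq_div]

theorem sq_sum_le_sum_parametrization {a b n : ℕ} (hb : b ≠ 0) (hcop : a.Coprime b)
    (f : ℕ × ℕ → ℝ) (hf : ∀ p, 0 ≤ f p) {N : ℕ} (hn : n ≤ N) :
    (∑ p ∈ (Icc 1 n ×ˢ Icc 1 n).filter (fun p => p.1 ^ a * p.2 ^ b = n), f p) ^ 2 ≤
      ∑ x ∈ (Icc 1 N ×ˢ Icc 1 N ×ˢ Icc 1 N ×ˢ Icc 1 N).filter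
          (fun x => x.2.2.1 ^ a * x.2.2.2 ^ b * (x.1 * x.2.1) ^ (a * b) = n),
        f (x.2.2.1 * x.1 ^ b, x.2.2.2 * x.2.1 ^ a) *
          f (x.2.2.1 * x.2.1 ^ b, x.2.2.2 * x.1 ^ a) := by
  set F := (Icc 1 n ×ˢ Icc 1 n).filter (fun p => p.1 ^ a * p.2 ^ b = n)
  set Q := (Icc 1 N ×ˢ Icc 1 N ×ˢ Icc 1 N ×ˢ Icc 1 N).filter
    (fun x => x.2.2.1 ^ a * x.2.2.2 ^ b * (x.1 * x.2.1) ^ (a * b) = n)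
  let ψ : ℕ × ℕ × ℕ × ℕ → (ℕ × ℕ) × ℕ × ℕ := fun x =>
    ((x.2.2.1 * x.1 ^ b, x.2.2.2 * x.2.1 ^ a), (x.2.2.1 * x.2.1 ^ b, x.2.2.2 * x.1 ^ a))
  have hsub : F ×ˢ F ⊆ Q.image ψ := by
    rintro ⟨⟨h, r⟩, ⟨H, R⟩⟩ hp
    simp only [F, mem_product, mem_filter, mem_Icc] at hp
    obtain ⟨⟨⟨⟨hh, hhn⟩, hr, hrn⟩, h₁⟩, ⟨⟨hH, hHn⟩, hR, hRn⟩, h₂⟩ := hp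
    obtain ⟨k, l, u, v, rfl, rfl, rfl, rfl⟩ := exists_common_parametrization hcop
      (by omega) (by omega) (h₁.trans h₂.symm)
    have hk : k ≠ 0 := by rintro rfl; simp at hh
    have hl : l ≠ 0 := by rintro rfl; simp at hr
    have hu : u ≠ 0 := by rintro rfl; simp [hb] at hh
    have hv : v ≠ 0 := by rintro rfl; simp [hb] at hH
    have hub : 1 ≤ u ^ b := Nat.one_le_pow _ _ (by omega)
    have hvb : 1 ≤ v ^ b := Nat.one_le_pow _ _ (by omega)
    have hva : 1 ≤ v ^ a := Nat.one_le_pow _ _ (by omega)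
    have hku : k ≤ k * u ^ b := Nat.le_mul_of_pos_right _ hub
    have huk : u ≤ k * u ^ b :=
      (Nat.le_self_pow hb u).trans (Nat.le_mul_of_pos_left _ (by omega))
    have hvk : v ≤ k * v ^ b :=
      (Nat.le_self_pow hb v).trans (Nat.le_mul_of_pos_left _ (by omega))
    have hlv : l ≤ l * v ^ a := Nat.le_mul_of_pos_right _ hva
    refine mem_image.2 ⟨(u, v, k, l), ?_, rfl⟩
    simp only [Q, mem_filter, mem_product, mem_Icc]
    refine ⟨by omega, ?_⟩
    rw [← h₁]
    ring
  calc (∑ p ∈ F, f p) ^ 2 = ∑ y ∈ F ×ˢ F, f y.1 * f y.2 := by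
        rw [sq, sum_mul_sum, sum_product]
    _ ≤ ∑ y ∈ Q.image ψ, f y.1 * f y.2 :=
        sum_le_sum_of_subset_of_nonneg hsub fun y _ _ ↦ mul_nonneg (hf _) (hf _)
    _ ≤ ∑ x ∈ Q, f (ψ x).1 * f (ψ x).2 :=
        sum_image_le_of_nonneg (g := ψ) (f := fun y => f y.1 * f y.2)
          fun _ _ ↦ mul_nonneg (hf _) (hf _)

theorem sum_parametrization_fiber_le {a b : ℕ} (ha : 0 < a) (hab : a < b) {X : ℝ} (hX : 0 < X)
    {u v k : ℕ} (hu : 0 < u) (hv : 0 < v) (hk : 0 < k) {α β : ℝ}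
    (hα : α = ((a : ℝ) + 2 * b) / (2 * a + 2 * b)) (hβ : β = (2 * (a : ℝ) + b) / (2 * a + 2 * b))
    (S : Finset ℕ)
    (hS : ∀ l ∈ S, X < (k : ℝ) ^ a * (l : ℝ) ^ b * ((u : ℝ) * v) ^ (a * b) ∧
      (k : ℝ) ^ a * (l : ℝ) ^ b * ((u : ℝ) * v) ^ (a * b) ≤ 2 * X) :
    ∑ l ∈ S, ((k * u ^ b : ℕ) : ℝ) ^ (-α) * ((l * v ^ a : ℕ) : ℝ) ^ (-β) *
        (((k * v ^ b : ℕ) : ℝ) ^ (-α) * ((l * u ^ a : ℕ) : ℝ) ^ (-β)) ≤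
      2 * X ^ (-((a : ℝ) / ((a + b) * b))) *
        ((u : ℝ) ^ (-(b : ℝ)) * (v : ℝ) ^ (-(b : ℝ)) * (k : ℝ) ^ (-1 - ((b : ℝ) - a) / b)) := by
  have hu' : (0 : ℝ) < u := by exact_mod_cast hu
  have hv' : (0 : ℝ) < v := by exact_mod_cast hv
  have hk' : (0 : ℝ) < k := by exact_mod_cast hk
  have ha' : (0 : ℝ) < a := by exact_mod_cast ha
  have hb' : (0 : ℝ) < b := by exact_mod_cast ha.trans hab
  set M : ℝ := (k : ℝ) ^ a * ((u : ℝ) * v) ^ (a * b) with hM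
  have hM0 : 0 < M := by positivity
  have hβ0 : 0 ≤ β := by rw [hβ]; positivity
  have hdyad := sum_rpow_neg_le_of_pow_dyadic (ha.trans hab) (s := 2 * β) (by positivity)
    (div_pos hX hM0) S fun l hl ↦ by
      rw [div_lt_iff₀ hM0, ← mul_div_assoc, le_div_iff₀ hM0,
        show (l : ℝ) ^ b * M = (k : ℝ) ^ a * (l : ℝ) ^ b * ((u : ℝ) * v) ^ (a * b) by
          rw [hM]; ring]
      exact hS l hl
  set c : ℝ := (k : ℝ) ^ (-(2 * α)) * ((u : ℝ) * v) ^ (-(b * α + a * β)) with hc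
  have hc0 : 0 ≤ c := by positivity
  have hterm : ∀ l ∈ S, ((k * u ^ b : ℕ) : ℝ) ^ (-α) * ((l * v ^ a : ℕ) : ℝ) ^ (-β) *
        (((k * v ^ b : ℕ) : ℝ) ^ (-α) * ((l * u ^ a : ℕ) : ℝ) ^ (-β)) =
      c * (l : ℝ) ^ (-(2 * β)) := by
    intro l _
    have hsq : ∀ x y : ℝ, 0 ≤ x → x ^ (-(2 * y)) = x ^ (-y) * x ^ (-y) := by
      intro x y hx
      rw [show -(2 * y) = -y * (2 : ℕ) by push_cast; ring, Real.rpow_mul_natCast hx, sq]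
    have hsplit : ∀ x : ℝ, 0 < x →
        x ^ (-(b * α + a * β)) = (x ^ b) ^ (-α) * (x ^ a) ^ (-β) := by
      intro x hx
      rw [← Real.rpow_natCast_mul hx.le, ← Real.rpow_natCast_mul hx.le, ← Real.rpow_add hx]
      ring_nf
    push_cast
    rw [hc, Real.mul_rpow hu'.le hv'.le, hsplit u hu', hsplit v hv', hsq k α hk'.le,
      hsq l β l.cast_nonneg]
    simp only [Real.mul_rpow, hu'.le, hv'.le, hk'.le, Nat.cast_nonneg, pow_nonneg]
    ring
  rw [sum_congr rfl hterm, ← mul_sum]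
  refine (mul_le_mul_of_nonneg_left hdyad hc0).trans_eq ?_
  have he : (1 - 2 * β) / b = -((a : ℝ) / ((a + b) * b)) := by rw [hβ]; field_simp; ring
  have hMpow : M ^ ((a : ℝ) / ((a + b) * b)) =
      (k : ℝ) ^ ((a : ℝ) * (a / ((a + b) * b))) *
        ((u : ℝ) * v) ^ ((a * b : ℝ) * (a / ((a + b) * b))) := by
    rw [hM, Real.mul_rpow (by positivity) (by positivity), ← Real.rpow_natCast_mul hk'.le,
      ← Real.rpow_natCast_mul (by positivity)]
    push_cast
    rfl
  rw [he, Real.div_rpow hX.le hM0.le, Real.rpow_neg hM0.le, div_inv_eq_mul, hMpow, hc,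
    show ∀ A B C D E : ℝ, A * B * (2 * (C * (D * E))) = 2 * C * ((B * E) * (A * D)) by
      intros; ring,
    ← Real.rpow_add hk', ← Real.rpow_add (by positivity), Real.mul_rpow hu'.le hv'.le]
  have huv : -(b * α + a * β) + (a * b : ℝ) * (a / ((a + b) * b)) = -(b : ℝ) := by
    rw [hα, hβ]; field_simp; ring
  have hkk : -(2 * α) + (a : ℝ) * (a / ((a + b) * b)) = -1 - ((b : ℝ) - a) / b := by
    rw [hα]; field_simp; ring
  rw [huv, hkk]

theorem g_sq_dyadic_sum (a b : ℕ) (ha : 0 < a) (hab : a < b) (hcop : Nat.Coprime a b) :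
    ∃ C : ℝ, 0 < C ∧ ∀ X : ℝ, 2 < X →
      ∑ n ∈ Finset.Ioc ⌊X⌋₊ ⌊2 * X⌋₊, (g a b n) ^ 2 ≤
        C * X ^ (-((a : ℝ) / ((a + b) * b))) := by
  have hb : 0 < b := ha.trans hab
  have hb' : (0 : ℝ) < b := by exact_mod_cast hb
  have hab' : (a : ℝ) < b := by exact_mod_cast hab
  have hsum₁ : Summable fun n : ℕ => (n : ℝ) ^ (-(b : ℝ)) :=
    Real.summable_nat_rpow.2 (neg_lt_neg (by exact_mod_cast (by omega : 1 < b)))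
  have hsum₂ : Summable fun n : ℕ => (n : ℝ) ^ (-1 - ((b : ℝ) - a) / b) :=
    Real.summable_nat_rpow.2 (sub_lt_self _ (div_pos (sub_pos.2 hab') hb'))
  set A := ∑' n : ℕ, (n : ℝ) ^ (-(b : ℝ))
  set B := ∑' n : ℕ, (n : ℝ) ^ (-1 - ((b : ℝ) - a) / b)
  have hA : 0 < A := hsum₁.tsum_pos (fun n ↦ by positivity) 1 (by simp)
  have hB : 0 < B := hsum₂.tsum_pos (fun n ↦ by positivity) 1 (by simp)
  refine ⟨2 * (A * A * B), by positivity, fun X hX ↦ ?_⟩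
  have hX0 : 0 < X := by linarith
  set N := ⌊2 * X⌋₊ with hN
  set α : ℝ := ((a : ℝ) + 2 * b) / (2 * a + 2 * b) with hα
  set β : ℝ := (2 * (a : ℝ) + b) / (2 * a + 2 * b) with hβ
  let f : ℕ × ℕ → ℝ := fun p => (p.1 : ℝ) ^ (-α) * (p.2 : ℝ) ^ (-β)
  let φ : ℕ × ℕ × ℕ × ℕ → ℕ := fun x => x.2.2.1 ^ a * x.2.2.2 ^ b * (x.1 * x.2.1) ^ (a * b)
  let w : ℕ × ℕ × ℕ × ℕ → ℝ := fun x => f (x.2.2.1 * x.1 ^ b, x.2.2.2 * x.2.1 ^ a) *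
          f (x.2.2.1 * x.2.1 ^ b, x.2.2.2 * x.1 ^ a)
  have hf : ∀ p, 0 ≤ f p := fun p ↦ by positivity
  set I := Icc 1 N
  set E := X ^ (-((a : ℝ) / ((a + b) * b))) with hE
  have hE0 : 0 < E := Real.rpow_pos_of_pos hX0 _
  calc ∑ n ∈ Finset.Ioc ⌊X⌋₊ N, (g a b n) ^ 2
      ≤ ∑ n ∈ Finset.Ioc ⌊X⌋₊ N, ∑ x ∈ I ×ˢ I ×ˢ I ×ˢ I with φ x = n, w x :=
        sum_le_sum fun n hn ↦
          sq_sum_le_sum_parametrization hb.ne' hcop f hf (mem_Ioc.1 hn).2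
    _ = ∑ x ∈ I ×ˢ I ×ˢ I ×ˢ I, if φ x ∈ Finset.Ioc ⌊X⌋₊ N then w x else 0 := by
        simp_rw [sum_filter]
        rw [sum_comm]
        simp_rw [sum_ite_eq]
    _ = ∑ u ∈ I, ∑ v ∈ I, ∑ k ∈ I, ∑ l ∈ I with φ (u, v, k, l) ∈ Finset.Ioc ⌊X⌋₊ N,
          w (u, v, k, l) := by
        simp_rw [sum_product, sum_filter]
    _ ≤ ∑ u ∈ I, ∑ v ∈ I, ∑ k ∈ I, 2 * E * ((u : ℝ) ^ (-(b : ℝ)) * (v : ℝ) ^ (-(b : ℝ)) *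
          (k : ℝ) ^ (-1 - ((b : ℝ) - a) / b)) := by
        refine sum_le_sum fun u hu ↦ sum_le_sum fun v hv ↦ sum_le_sum fun k hk ↦ ?_
        refine sum_parametrization_fiber_le ha hab hX0 (mem_Icc.1 hu).1 (mem_Icc.1 hv).1
          (mem_Icc.1 hk).1 hα hβ _ fun l hl ↦ ?_
        obtain ⟨h₁, h₂⟩ := mem_Ioc.1 (mem_filter.1 hl).2
        rw [Nat.floor_lt hX0.le] at h₁
        rw [hN, Nat.le_floor_iff (by positivity)] at h₂
        exact ⟨by exact_mod_cast h₁, by exact_mod_cast h₂⟩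
    _ = 2 * E * ((∑ u ∈ I, (u : ℝ) ^ (-(b : ℝ))) * (∑ v ∈ I, (v : ℝ) ^ (-(b : ℝ))) *
          ∑ k ∈ I, (k : ℝ) ^ (-1 - ((b : ℝ) - a) / b)) := by
        simp_rw [← mul_sum, ← sum_mul, ← mul_sum, ← sum_mul]
    _ ≤ 2 * E * (A * A * B) := by
        gcongr
        · exact hsum₁.sum_le_tsum _ fun _ _ ↦ by positivity
        · exact hsum₁.sum_le_tsum _ fun _ _ ↦ by positivity
        · exact hsum₂.sum_le_tsum _ fun _ _ ↦ by positivity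
    _ = 2 * (A * A * B) * E := by ring
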